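/- Fix d_disc, d_cont, m ∈ ℕ and T > 0. Let C : [0,T] → ℝ^{d_cont} be a continuous path, let t be a strictly increasing m-tuple in [0,T], and let δ ∈ (ℝ^{2·d_disc})^m. Then for every index i ∈ {0, …, m−1}, the increment of the realised path across the i-th event segment recovers the i-th event increment: Ψ_{C,t,δ}(2 + t_i + i) − Ψ_{C,t,δ}(1 + t_i + i) = δ̃_i, where δ̃_i ∈ ℝ^{d_X} is the embedding of δ_i into the first 2·d_disc coordinates. -/

import Mathlib

/-- `clamp s = min 1 (max 0 s)`. -/
noncomputable def clamp (s : ℝ) : ℝ := min 1 (max 0 s)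

/-- The physical-time coordinate `q_t` of the realised path for event times `t`. -/
noncomputable def qt {m : ℕ} (t : Fin m → ℝ) (u : ℝ) : ℝ :=
  u - clamp u - ∑ i : Fin m, clamp (u - 1 - t i - (i : ℝ))

/-- Embed `v ∈ ℝ^{d_cont}` into `ℝ^{2·d_disc + d_cont}`, occupying the last `d_cont`
coordinates, with zeros elsewhere. -/
noncomputable def embedCont (dd dc : ℕ) (v : Fin dc → ℝ) : Fin (2 * dd + dc) → ℝ :=
  fun k => if h : (k : ℕ) < 2 * dd then 0
    else v ⟨(k : ℕ) - 2 * dd, by have := k.isLt; omega⟩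

/-- Embed `w ∈ ℝ^{2·d_disc}` into `ℝ^{2·d_disc + d_cont}`, occupying the first
`2·d_disc` coordinates, with zeros elsewhere. -/
noncomputable def embedDisc (dd dc : ℕ) (w : Fin (2 * dd) → ℝ) : Fin (2 * dd + dc) → ℝ :=
  fun k => if h : (k : ℕ) < 2 * dd then w ⟨(k : ℕ), h⟩ else 0

/-- The realised path `Ψ_{C,t,δ} : [0, T+m+1] → ℝ^{d_X}` associated with a continuous
path `C` of continuously observed channels, event times `t`, and event increments `δ`. -/
noncomputable def Psi (dd dc m : ℕ) (C : ℝ → Fin dc → ℝ) (t : Fin m → ℝ)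
    (δ : Fin m → Fin (2 * dd) → ℝ) (u : ℝ) : Fin (2 * dd + dc) → ℝ :=
  clamp u • embedCont dd dc (C 0)
    + (embedCont dd dc (C (qt t u)) - embedCont dd dc (C 0))
    + ∑ i : Fin m, clamp (u - 1 - t i - (i : ℝ)) • embedDisc dd dc (δ i)

lemma clamp_of_nonpos {s : ℝ} (hs : s ≤ 0) : clamp s = 0 := by
  simp [clamp, max_eq_left hs]

lemma clamp_of_one_le {s : ℝ} (hs : 1 ≤ s) : clamp s = 1 := by
  rw [clamp, max_eq_right (zero_le_one.trans hs), min_eq_left hs]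

/-- Across the `i`-th event segment only the `i`-th clamp changes, from `0` to `1`. -/
lemma clamp_event_end {m : ℕ} {t : Fin m → ℝ} (ht : StrictMono t) (i j : Fin m) :
    clamp (2 + t i + (i : ℝ) - 1 - t j - (j : ℝ))
      = clamp (1 + t i + (i : ℝ) - 1 - t j - (j : ℝ)) + if j = i then 1 else 0 := by
  rcases lt_trichotomy j i with h | rfl | h
  · have h₁ := ht h
    have h₂ : (j : ℝ) + 1 ≤ (i : ℝ) := by exact_mod_cast h
    rw [clamp_of_one_le (by linarith), clamp_of_one_le (by linarith), if_neg h.ne, add_zero]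
  · rw [clamp_of_one_le (by linarith), clamp_of_nonpos (by linarith), if_pos rfl, zero_add]
  · have h₁ := ht h
    have h₂ : (i : ℝ) + 1 ≤ (j : ℝ) := by exact_mod_cast h
    rw [clamp_of_nonpos (by linarith), clamp_of_nonpos (by linarith), if_neg h.ne', add_zero]

/-- The physical-time coordinate agrees at the two ends of an event segment. -/
lemma qt_event_end {m : ℕ} {t : Fin m → ℝ} (ht : StrictMono t) (i : Fin m) (hi : 0 ≤ t i) :
    qt t (2 + t i + (i : ℝ)) = qt t (1 + t i + (i : ℝ)) := by
  have hi' : (0 : ℝ) ≤ (i : ℝ) := Nat.cast_nonneg _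
  simp only [qt, clamp_event_end ht, Finset.sum_add_distrib, Finset.sum_ite_eq',
    Finset.mem_univ, if_true]
  rw [clamp_of_one_le (by linarith), clamp_of_one_le (by linarith)]
  ring

/-- **The realised path recovers the event increments.** The increment of `Ψ_{C,t,δ}`
across the `i`-th event segment `[1 + t_i + i, 2 + t_i + i]` equals the embedded event
increment `δ̃_i`. -/
theorem psi_event_increment
    (dd dc m : ℕ) (T : ℝ) (hT : 0 < T)
    (C : ℝ → Fin dc → ℝ) (hCcont : ContinuousOn C (Set.Icc 0 T))
    (t : Fin m → ℝ) (ht : StrictMono t) (htmem : ∀ i, t i ∈ Set.Icc 0 T)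
    (δ : Fin m → Fin (2 * dd) → ℝ) :
    ∀ i : Fin m,
      Psi dd dc m C t δ (2 + t i + (i : ℝ)) - Psi dd dc m C t δ (1 + t i + (i : ℝ))
        = embedDisc dd dc (δ i) := by
  intro i
  have hi := (htmem i).1
  have hi' : (0 : ℝ) ≤ (i : ℝ) := Nat.cast_nonneg _
  simp only [Psi, qt_event_end ht i hi, clamp_event_end ht, add_smul, Finset.sum_add_distrib,
    ite_smul, one_smul, zero_smul, Finset.sum_ite_eq', Finset.mem_univ, if_true]
  rw [clamp_of_one_le (by linarith : 1 ≤ 2 + t i + (i : ℝ)),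
    clamp_of_one_le (by linarith : 1 ≤ 1 + t i + (i : ℝ))]
  abel
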